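/- Weierstrass factorization (existence of entire function with prescribed zeros): given a sequence (a_n) of nonzero complex numbers with |a_n| → ∞, there exists an entire function G, not identically zero, whose zero set is exactly {a_n} (with multiplicities given by repetitions in the sequence). -/

import Mathlib

/-- The Weierstrass primary factor `(1 + w) * exp (-(w - w ^ 2 / 2 + ⋯ ± w ^ n / n))`. -/
noncomputable def weierstrassFactor (n : ℕ) (w : ℂ) : ℂ :=
  (1 + w) * Complex.exp (-Complex.logTaylor (n + 1) w)

theorem weierstrassFactor_eq_zero_iff {n : ℕ} {w : ℂ} :
    weierstrassFactor n w = 0 ↔ 1 + w = 0 := by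
  simp [weierstrassFactor, Complex.exp_ne_zero]

theorem differentiable_weierstrassFactor (n : ℕ) : Differentiable ℂ (weierstrassFactor n) := by
  have h : Differentiable ℂ (Complex.logTaylor (n + 1)) := fun z =>
    (Complex.hasDerivAt_logTaylor n z).differentiableAt
  unfold weierstrassFactor
  fun_prop

theorem norm_weierstrassFactor_sub_one_le (n : ℕ) {w : ℂ} (hw : ‖w‖ ≤ 1 / 2) :
    ‖weierstrassFactor n w - 1‖ ≤ 2 * (1 / 2) ^ n := by
  have hw1 : ‖w‖ < 1 := by linarith
  have hne : 1 + w ≠ 0 := fun h => by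
    rw [eq_neg_of_add_eq_zero_right h, norm_neg, norm_one] at hw1
    exact lt_irrefl _ hw1
  have hexp : weierstrassFactor n w
      = Complex.exp (Complex.log (1 + w) - Complex.logTaylor (n + 1) w) := by
    rw [weierstrassFactor, sub_eq_add_neg, Complex.exp_add, Complex.exp_log hne]
  have hinv : (1 - ‖w‖)⁻¹ ≤ 2 := by
    rw [inv_le_comm₀ (by linarith) two_pos]
    linarith
  have hinv0 : 0 ≤ (1 - ‖w‖)⁻¹ := inv_nonneg.2 (by linarith)
  have hbound : ‖Complex.log (1 + w) - Complex.logTaylor (n + 1) w‖ ≤ (1 / 2) ^ n :=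
    calc _ ≤ ‖w‖ ^ (n + 1) * (1 - ‖w‖)⁻¹ / (n + 1) := Complex.norm_log_sub_logTaylor_le n hw1
      _ ≤ ‖w‖ ^ (n + 1) * (1 - ‖w‖)⁻¹ := div_le_self (by positivity) (by simp)
      _ ≤ (1 / 2) ^ (n + 1) * 2 := by gcongr
      _ = (1 / 2) ^ n := by ring
  rw [hexp]
  refine (Complex.norm_exp_sub_one_le
    (hbound.trans (pow_le_one₀ (by norm_num) (by norm_num)))).trans ?_
  gcongr

/-- Weierstrass factorization (existence of an entire function with prescribed zeros):
given a sequence `aₙ` of nonzero complex numbers with `|aₙ| → ∞`, there is an entire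
function `G`, not identically zero, whose zero set is exactly `{aₙ}`. -/
theorem weierstrass_prescribed_zeros (a : ℕ → ℂ) (ha : ∀ n, a n ≠ 0)
    (hlim : Filter.Tendsto (fun n => ‖a n‖) Filter.atTop Filter.atTop) :
    ∃ G : ℂ → ℂ, Differentiable ℂ G ∧ G ≠ 0 ∧ ∀ z : ℂ, G z = 0 ↔ ∃ n, z = a n := by
  set f : ℕ → ℂ → ℂ := fun n z => weierstrassFactor n (-z / a n) - 1 with hf
  have hdiff (n : ℕ) : Differentiable ℂ (f n) :=
    ((differentiable_weierstrassFactor n).comp (by fun_prop)).sub_const 1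
  have hsum : Summable fun n : ℕ => 2 * (1 / 2 : ℝ) ^ n := summable_geometric_two.mul_left 2
  have hbound (R : ℝ) :
      ∀ᶠ n in Filter.atTop, ∀ z ∈ Metric.ball (0 : ℂ) R, ‖f n z‖ ≤ 2 * (1 / 2 : ℝ) ^ n := by
    filter_upwards [hlim.eventually_ge_atTop (2 * R)] with n hn z hz
    refine norm_weierstrassFactor_sub_one_le n ?_
    rw [norm_div, norm_neg, div_le_iff₀ (norm_pos_iff.2 (ha n))]
    linarith [mem_ball_zero_iff.1 hz]
  have hzero (n : ℕ) (z : ℂ) : 1 + f n z = 0 ↔ z = a n := by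
    rw [hf, add_sub_cancel, weierstrassFactor_eq_zero_iff, neg_div, ← sub_eq_add_neg, sub_eq_zero,
      eq_comm, div_eq_one_iff_eq (ha n)]
  have hG (z : ℂ) : ∏' n, (1 + f n z) = 0 ↔ ∃ n, z = a n := by
    constructor
    · contrapose!
      intro h
      have hsummable : Summable fun n => f n z := by
        refine hsum.of_norm_bounded_eventually_nat ?_
        filter_upwards [hbound (‖z‖ + 1)] with n hn
        exact hn z (by simp)
      exact tprod_one_add_ne_zero_of_summable (fun n => (hzero n z).not.2 (h n)) hsummable.norm
    · rintro ⟨n, hn⟩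
      exact tprod_of_exists_eq_zero ⟨n, (hzero n z).2 hn⟩
  refine ⟨fun z => ∏' n, (1 + f n z), fun z => ?_, fun h => ?_, hG⟩
  · have hprod := hsum.hasProdLocallyUniformlyOn_nat_one_add Metric.isOpen_ball (hbound (‖z‖ + 1))
      fun n => (hdiff n).continuous.continuousOn
    refine (hprod.tendstoLocallyUniformlyOn_finsetRange.differentiableOn
      (Filter.Eventually.of_forall fun N => ?_) Metric.isOpen_ball).differentiableAt
      (Metric.isOpen_ball.mem_nhds (by simp))
    exact (Differentiable.fun_finsetProd fun n _ => (hdiff n).const_add 1).differentiableOn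
  · obtain ⟨n, hn⟩ := (hG 0).1 (congrFun h 0)
    exact ha n hn.symm
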